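/- arXiv:2207.11487 — 2 statements merged into one kernel-verified Lean document; each statement's English description precedes it below -/
import Mathlib

section
/- Let $\{X_{\mathbf{n}}, \mathbf{n}\in\mathbb{Z}^d_+\}$ be a $d$-dimensional array of pairwise independent random vectors in a real separable Hilbert space $\mathcal{H}$. If $\{\|X_{\mathbf{n}}\|\}$ is uniformly integrable in the Cesàro sense, then $|\mathbf{n}|^{-1}\max_{\mathbf{1}\prec\mathbf{k}\prec\mathbf{n}}\|\sum_{\mathbf{i}\prec\mathbf{k}}(X_{\mathbf{i}}-\mathbb{E}X_{\mathbf{i}})\| \to 0$ in $L_1$ as $|\mathbf{n}|\to\infty$. -/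
open MeasureTheory Filter Finset ProbabilityTheory

/-- Second moment bound for sums of pairwise independent, centered, bounded random vectors. -/
theorem integral_norm_sum_sq_le_of_pairwise_indepFun
    {Ω H ι : Type*} [MeasurableSpace Ω]
    [NormedAddCommGroup H] [InnerProductSpace ℝ H] [CompleteSpace H]
    [MeasurableSpace H] [BorelSpace H]
    {P : Measure Ω} [IsProbabilityMeasure P] {W : ι → Ω → H} {B : ℝ}
    (hW : ∀ i, Integrable (W i) P) (hB : ∀ i ω, ‖W i ω‖ ≤ B)
    (hmean : ∀ i, ∫ ω, W i ω ∂P = 0)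
    (hindep : ∀ i j, i ≠ j → IndepFun (W i) (W j) P) (s : Finset ι) :
    ∫ ω, ‖∑ i ∈ s, W i ω‖ ^ 2 ∂P ≤ B ^ 2 * #s := by
  classical
  have hinner_le : ∀ i j ω, ‖(inner ℝ (W i ω) (W j ω) : ℝ)‖ ≤ B ^ 2 := fun i j ω => by
    rw [pow_two]
    exact (norm_inner_le_norm _ _).trans (mul_le_mul (hB i ω) (hB j ω) (norm_nonneg _)
      ((norm_nonneg _).trans (hB i ω)))
  have hinner_int : ∀ i j, Integrable (fun ω => (inner ℝ (W i ω) (W j ω) : ℝ)) P := fun i j =>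
    Integrable.of_bound ((hW i).aestronglyMeasurable.inner (hW j).aestronglyMeasurable) (B ^ 2)
      (Eventually.of_forall (hinner_le i j))
  have hcross : ∀ i j, ∫ ω, (inner ℝ (W i ω) (W j ω) : ℝ) ∂P ≤ if i = j then B ^ 2 else 0 := by
    intro i j
    split_ifs with h
    · have := norm_integral_le_of_norm_le_const (μ := P) (Eventually.of_forall (hinner_le i j))
      simp only [probReal_univ, mul_one] at this
      exact (le_abs_self _).trans this
    · have := (hindep i j h).integral_bilin (hW i) (hW j) (innerSL ℝ)
      rw [hmean i, map_zero, zero_apply] at this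
      exact this.le
  calc ∫ ω, ‖∑ i ∈ s, W i ω‖ ^ 2 ∂P
      = ∫ ω, ∑ i ∈ s, ∑ j ∈ s, (inner ℝ (W i ω) (W j ω) : ℝ) ∂P := by
        congr 1 with ω
        rw [← real_inner_self_eq_norm_sq, sum_inner]
        simp_rw [inner_sum]
    _ = ∑ i ∈ s, ∑ j ∈ s, ∫ ω, (inner ℝ (W i ω) (W j ω) : ℝ) ∂P := by
        rw [integral_finsetSum _ fun i _ => integrable_finsetSum _ fun j _ => hinner_int i j]
        refine sum_congr rfl fun i _ => integral_finsetSum _ fun j _ => hinner_int i j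
    _ ≤ ∑ i ∈ s, ∑ j ∈ s, if i = j then B ^ 2 else 0 :=
        sum_le_sum fun i _ => sum_le_sum fun j _ => hcross i j
    _ = B ^ 2 * #s := by simp [mul_comm]

/-- First moment bound for sums of pairwise independent, centered, bounded random vectors. -/
theorem integral_norm_sum_le_of_pairwise_indepFun
    {Ω H ι : Type*} [MeasurableSpace Ω]
    [NormedAddCommGroup H] [InnerProductSpace ℝ H] [CompleteSpace H]
    [MeasurableSpace H] [BorelSpace H]
    {P : Measure Ω} [IsProbabilityMeasure P] {W : ι → Ω → H} {B : ℝ} (hB0 : 0 ≤ B)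
    (hW : ∀ i, Integrable (W i) P) (hB : ∀ i ω, ‖W i ω‖ ≤ B)
    (hmean : ∀ i, ∫ ω, W i ω ∂P = 0)
    (hindep : ∀ i j, i ≠ j → IndepFun (W i) (W j) P) (s : Finset ι) :
    ∫ ω, ‖∑ i ∈ s, W i ω‖ ∂P ≤ B * √(#s : ℝ) := by
  have hint : Integrable (fun ω => ∑ i ∈ s, W i ω) P := integrable_finsetSum _ fun i _ => hW i
  have hL2 : MemLp (fun ω => ‖∑ i ∈ s, W i ω‖) 2 P := by
    refine MemLp.of_bound hint.norm.aestronglyMeasurable (∑ i ∈ s, B)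
      (Eventually.of_forall fun ω => ?_)
    rw [norm_norm]
    exact norm_sum_le_of_le _ fun i _ => hB i ω
  have hvar := variance_nonneg (fun ω => ‖∑ i ∈ s, W i ω‖) P
  rw [variance_eq_sub hL2] at hvar
  have hsq := integral_norm_sum_sq_le_of_pairwise_indepFun hW hB hmean hindep s
  refine abs_le_of_sq_le_sq' ?_ (by positivity) |>.2
  rw [mul_pow, Real.sq_sqrt (by positivity)]
  simp only [Pi.pow_apply] at hvar
  linarith

/-- Rounding of `k` down, in each coordinate `j`, to a multiple of `n j / m + 1`. -/
def gridFloor {d : ℕ} (m : ℕ) (n k : Fin d → ℕ) : Fin d → ℕ :=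
  fun j => (n j / m + 1) * (k j / (n j / m + 1))

theorem gridFloor_le {d : ℕ} (m : ℕ) (n k : Fin d → ℕ) : gridFloor m n k ≤ k :=
  fun _ => Nat.mul_div_le _ _

theorem card_image_gridFloor_le {d m : ℕ} (hm : 0 < m) (n : Fin d → ℕ) :
    #((Icc 1 n).image (gridFloor m n)) ≤ (m + 1) ^ d := by
  calc #((Icc 1 n).image (gridFloor m n))
      ≤ #((Fintype.piFinset fun _ : Fin d => range (m + 1)).image
          fun q j => (n j / m + 1) * q j) := by
        refine card_le_card fun g hg => ?_
        obtain ⟨k, hk, rfl⟩ := mem_image.1 hg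
        refine mem_image.2 ⟨fun j => k j / (n j / m + 1), ?_, rfl⟩
        simp only [Fintype.mem_piFinset, mem_range, Nat.lt_succ_iff]
        intro j
        refine Nat.div_le_of_le_mul (((mem_Icc.1 hk).2 j).trans ?_)
        rw [mul_comm]
        exact (Nat.lt_mul_div_succ _ hm).le
    _ ≤ #(Fintype.piFinset fun _ : Fin d => range (m + 1)) := card_image_le
    _ = (m + 1) ^ d := by simp

theorem card_Icc_sdiff_Icc_gridFloor_le {d m : ℕ} (n : Fin d → ℕ) {k : Fin d → ℕ}
    (hk : k ≤ n) :
    m * #(Icc 1 k \ Icc 1 (gridFloor m n k)) ≤ d * ∏ j, n j := by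
  classical
  have hslab : ∀ j, m * #(Icc (Function.update (1 : Fin d → ℕ) j (gridFloor m n k j + 1))
      (Function.update n j (k j))) ≤ ∏ l, n l := by
    intro j
    rw [Pi.card_Icc, ← mul_prod_erase univ _ (mem_univ j), ← mul_prod_erase univ n (mem_univ j),
      ← mul_assoc]
    refine Nat.mul_le_mul ?_ (prod_le_prod' fun l hl => ?_)
    · simp only [Function.update_self, Nat.card_Icc]
      have h1 : k j + 1 - (gridFloor m n k j + 1) ≤ n j / m := by
        have := Nat.div_add_mod (k j) (n j / m + 1)
        have := Nat.mod_lt (k j) (Nat.add_one_pos (n j / m))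
        simp only [gridFloor]
        lia
      exact (Nat.mul_le_mul_left m h1).trans (Nat.mul_div_le _ _)
    · simp [Function.update_of_ne (ne_of_mem_erase hl)]
  have hsub : Icc 1 k \ Icc 1 (gridFloor m n k) ⊆
      univ.biUnion fun j => Icc (Function.update (1 : Fin d → ℕ) j (gridFloor m n k j + 1))
        (Function.update n j (k j)) := by
    intro i hi
    simp only [Finset.mem_sdiff, mem_Icc, not_and] at hi
    obtain ⟨⟨h1, hik⟩, hnot⟩ := hi
    obtain ⟨j, hj⟩ := not_forall.1 (hnot h1)
    refine mem_biUnion.2 ⟨j, mem_univ j, mem_Icc.2 ⟨?_, ?_⟩⟩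
    · exact update_le_iff.2 ⟨Nat.lt_of_not_le hj, fun l _ => h1 l⟩
    · exact le_update_iff.2 ⟨hik j, fun l _ => (hik l).trans (hk l)⟩
  calc m * #(Icc 1 k \ Icc 1 (gridFloor m n k))
      ≤ m * ∑ j, #(Icc (Function.update (1 : Fin d → ℕ) j (gridFloor m n k j + 1))
        (Function.update n j (k j))) :=
        Nat.mul_le_mul_left m ((card_le_card hsub).trans card_biUnion_le)
    _ ≤ ∑ _j : Fin d, ∏ l, n l := by
        rw [mul_sum]
        exact sum_le_sum fun j _ => hslab j
    _ = d * ∏ j, n j := by simp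

/-- The partial sums of a bounded array over all boxes in `Icc 1 n` are controlled by those over
the boxes with corner on a grid of at most `(m + 1) ^ d` points. -/
theorem norm_sum_Icc_le_sum_gridFloor {H : Type*} [NormedAddCommGroup H] {d m : ℕ} (hm : 0 < m)
    {n k : Fin d → ℕ} (hk : k ∈ Icc 1 n) {x : (Fin d → ℕ) → H} {B : ℝ} (hB0 : 0 ≤ B)
    (hB : ∀ i, ‖x i‖ ≤ B) :
    ‖∑ i ∈ Icc 1 k, x i‖ ≤ ∑ g ∈ (Icc 1 n).image (gridFloor m n), ‖∑ i ∈ Icc 1 g, x i‖ +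
      B * (d * ∏ j, (n j : ℝ)) / m := by
  have hsub : Icc 1 (gridFloor m n k) ⊆ Icc 1 k := Icc_subset_Icc_right (gridFloor_le m n k)
  rw [← sum_sdiff hsub, add_comm]
  refine (norm_add_le _ _).trans (add_le_add ?_ ?_)
  · exact single_le_sum (f := fun g => ‖∑ i ∈ Icc 1 g, x i‖) (fun _ _ => norm_nonneg _)
      (mem_image_of_mem _ hk)
  · refine (norm_sum_le_of_le _ fun i _ => hB i).trans ?_
    have h := card_Icc_sdiff_Icc_gridFloor_le (m := m) n (mem_Icc.1 hk).2
    have h' : (m : ℝ) * #(Icc 1 k \ Icc 1 (gridFloor m n k)) ≤ d * ∏ j, (n j : ℝ) := by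
      exact_mod_cast h
    rw [sum_const, nsmul_eq_mul, le_div_iff₀ (by positivity)]
    nlinarith [mul_le_mul_of_nonneg_left h' hB0]

/-- Nonasymptotic bound obtained by truncating the array at level `a`. -/
theorem integral_sup_norm_sum_le
    {Ω H : Type*} [MeasurableSpace Ω]
    [NormedAddCommGroup H] [InnerProductSpace ℝ H] [CompleteSpace H]
    [MeasurableSpace H] [BorelSpace H]
    {P : Measure Ω} [IsProbabilityMeasure P] {d : ℕ} {X : (Fin d → ℕ) → Ω → H}
    (hmeas : ∀ i, Measurable (X i)) (hint : ∀ i, Integrable (X i) P)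
    (hindep : ∀ i j, i ≠ j → IndepFun (X i) (X j) P)
    {a : ℝ} (ha : 0 ≤ a) {m : ℕ} (hm : 0 < m) (n : Fin d → ℕ) :
    ∫ ω, (((Icc 1 n).sup fun k =>
        ‖∑ i ∈ Icc 1 k, (X i ω - ∫ ω', X i ω' ∂P)‖₊ : NNReal) : ℝ) ∂P ≤
      (m + 1) ^ d * (2 * a * √(∏ j, (n j : ℝ))) + 2 * a * (d * ∏ j, (n j : ℝ)) / m +
      2 * ∑ i ∈ Icc 1 n, ∫ ω, Set.indicator {ω | a < ‖X i ω‖} (fun ω => ‖X i ω‖) ω ∂P := by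
  set T : H → H := Set.indicator {x | ‖x‖ ≤ a} id with hT
  have hTmeas : Measurable T := measurable_id.indicator (measurableSet_le measurable_norm
    measurable_const)
  have hTa : ∀ x, ‖T x‖ ≤ a := fun x => by
    by_cases h : ‖x‖ ≤ a <;> simp [hT, h, ha]
  have hTX : ∀ i, Integrable (fun ω => T (X i ω)) P := fun i => by
    have : (fun ω => T (X i ω)) = Set.indicator {ω | ‖X i ω‖ ≤ a} (X i) := by
      ext ω; simp [hT, Set.indicator]
    rw [this]
    exact (hint i).indicator (measurableSet_le (hmeas i).norm measurable_const)
  set E : (Fin d → ℕ) → H := fun i => ∫ ω, T (X i ω) ∂P with hE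
  have hEa : ∀ i, ‖E i‖ ≤ a := fun i => by
    simpa using norm_integral_le_of_norm_le_const (μ := P)
      (Eventually.of_forall fun ω => hTa (X i ω))
  set R : (Fin d → ℕ) → Ω → ℝ :=
    fun i => Set.indicator {ω | a < ‖X i ω‖} (fun ω => ‖X i ω‖) with hR
  have hRint : ∀ i, Integrable (R i) P := fun i =>
    (hint i).norm.indicator (measurableSet_lt measurable_const (hmeas i).norm)
  have hXT : ∀ i ω, ‖X i ω - T (X i ω)‖ = R i ω := fun i ω => by
    by_cases h : ‖X i ω‖ ≤ a
    · simp [hT, hR, h, not_lt.2 h]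
    · simp [hT, hR, h, not_le.1 h]
  have hXE : ∀ i, ‖∫ ω, X i ω ∂P - E i‖ ≤ ∫ ω, R i ω ∂P := fun i => by
    rw [hE, ← integral_sub (hint i) (hTX i)]
    refine (norm_integral_le_integral_norm _).trans_eq ?_
    simp_rw [hXT]
  set W : (Fin d → ℕ) → Ω → H := fun i ω => T (X i ω) - E i with hW
  have hWint : ∀ i, Integrable (W i) P := fun i => (hTX i).sub (integrable_const _)
  have hWB : ∀ i ω, ‖W i ω‖ ≤ 2 * a := fun i ω => by
    refine (norm_sub_le _ _).trans ?_
    linarith [hTa (X i ω), hEa i]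
  have hWmean : ∀ i, ∫ ω, W i ω ∂P = 0 := fun i => by
    simp [hW, integral_sub (hTX i) (integrable_const _), hE]
  have hWindep : ∀ i j, i ≠ j → IndepFun (W i) (W j) P := fun i j hij =>
    (hindep i j hij).comp (φ := fun x => T x - E i) (ψ := fun x => T x - E j)
      (hTmeas.sub_const _) (hTmeas.sub_const _)
  set G := (Icc 1 n).image (gridFloor m n) with hG
  have hpoint : ∀ ω, (((Icc 1 n).sup fun k =>
      ‖∑ i ∈ Icc 1 k, (X i ω - ∫ ω', X i ω' ∂P)‖₊ : NNReal) : ℝ) ≤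
      ∑ g ∈ G, ‖∑ i ∈ Icc 1 g, W i ω‖ + 2 * a * (d * ∏ j, (n j : ℝ)) / m +
        ∑ i ∈ Icc 1 n, (R i ω + ∫ ω', R i ω' ∂P) := by
    intro ω
    have hRnn : ∀ i, 0 ≤ R i ω + ∫ ω', R i ω' ∂P := fun i =>
      add_nonneg ((norm_nonneg _).trans_eq (hXT i ω)) ((norm_nonneg _).trans (hXE i))
    have hnn : 0 ≤ ∑ g ∈ G, ‖∑ i ∈ Icc 1 g, W i ω‖ + 2 * a * (d * ∏ j, (n j : ℝ)) / m +
        ∑ i ∈ Icc 1 n, (R i ω + ∫ ω', R i ω' ∂P) :=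
      add_nonneg (by positivity) (sum_nonneg fun i _ => hRnn i)
    rw [← Real.le_toNNReal_iff_coe_le hnn]
    refine Finset.sup_le fun k hk => ?_
    rw [Real.le_toNNReal_iff_coe_le hnn, coe_nnnorm]
    have hsplit : ∑ i ∈ Icc 1 k, (X i ω - ∫ ω', X i ω' ∂P) = ∑ i ∈ Icc 1 k, W i ω +
        ∑ i ∈ Icc 1 k, ((X i ω - T (X i ω)) - (∫ ω', X i ω' ∂P - E i)) := by
      rw [← sum_add_distrib]
      refine sum_congr rfl fun i _ => ?_
      simp only [hW]
      abel
    rw [hsplit]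
    refine (norm_add_le _ _).trans (add_le_add
      (norm_sum_Icc_le_sum_gridFloor hm hk (by positivity) fun i => hWB i ω) ?_)
    calc _ ≤ ∑ i ∈ Icc 1 k, (R i ω + ∫ ω', R i ω' ∂P) := norm_sum_le_of_le _ fun i _ =>
          (norm_sub_le _ _).trans (add_le_add (hXT i ω).le (hXE i))
      _ ≤ _ := sum_le_sum_of_subset_of_nonneg (Icc_subset_Icc_right (mem_Icc.1 hk).2)
          fun i _ _ => hRnn i
  have hint1 : ∀ g ∈ G, Integrable (fun ω => ‖∑ i ∈ Icc 1 g, W i ω‖) P := fun g _ =>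
    (integrable_finsetSum _ fun i _ => hWint i).norm
  have hint2 : ∀ i ∈ Icc 1 n, Integrable (fun ω => R i ω + ∫ ω', R i ω' ∂P) P := fun i _ =>
    (hRint i).add (integrable_const _)
  have hint12 : Integrable (fun ω => ∑ g ∈ G, ‖∑ i ∈ Icc 1 g, W i ω‖ +
      2 * a * (d * ∏ j, (n j : ℝ)) / m) P :=
    (integrable_finsetSum _ hint1).add (integrable_const _)
  refine (integral_mono_of_nonneg (Eventually.of_forall fun ω => NNReal.coe_nonneg _)
    (hint12.add (integrable_finsetSum _ hint2)) (Eventually.of_forall hpoint)).trans ?_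
  simp only [Pi.add_apply]
  rw [integral_add hint12 (integrable_finsetSum _ hint2),
    integral_add (integrable_finsetSum _ hint1) (integrable_const _),
    integral_finsetSum _ hint1, integral_finsetSum _ hint2, integral_const, probReal_univ,
    one_smul, mul_sum]
  refine add_le_add (add_le_add_left ?_ _) (sum_le_sum fun i _ => ?_)
  · calc ∑ g ∈ G, ∫ ω, ‖∑ i ∈ Icc 1 g, W i ω‖ ∂P
        ≤ ∑ g ∈ G, 2 * a * √(∏ j, (n j : ℝ)) := by
          refine sum_le_sum fun g hg => ?_
          refine (integral_norm_sum_le_of_pairwise_indepFun (by positivity) hWint hWB hWmean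
            hWindep _).trans ?_
          obtain ⟨k, hk, rfl⟩ := mem_image.1 hg
          gcongr
          have : #(Icc 1 (gridFloor m n k)) ≤ #(Icc 1 n) := card_le_card
            (Icc_subset_Icc_right ((gridFloor_le m n k).trans (mem_Icc.1 hk).2))
          simp only [Pi.card_Icc (1 : Fin d → ℕ) n, Pi.one_apply, Nat.card_Icc,
            add_tsub_cancel_right] at this
          exact_mod_cast this
      _ ≤ (m + 1) ^ d * (2 * a * √(∏ j, (n j : ℝ))) := by
          rw [sum_const, nsmul_eq_mul]
          gcongr
          exact_mod_cast card_image_gridFloor_le hm n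
  · rw [integral_add (hRint i) (integrable_const _), integral_const, probReal_univ, one_smul,
      two_mul]

/-- Theorem 2.2: L_1 convergence of maximal normed partial sums of centered, pairwise
independent Hilbert-space-valued random vectors whose norms are Cesàro uniformly
integrable. -/
theorem l1_convergence_maximal_sums
    {Ω H : Type*} [MeasurableSpace Ω]
    [NormedAddCommGroup H] [InnerProductSpace ℝ H] [CompleteSpace H]
    [SecondCountableTopology H] [MeasurableSpace H] [BorelSpace H]
    (P : Measure Ω) [IsProbabilityMeasure P]
    (d : ℕ) (hd : 0 < d)
    (X : (Fin d → ℕ) → Ω → H)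
    (hmeas : ∀ i, Measurable (X i))
    (hint : ∀ i, Integrable (X i) P)
    (hindep : ∀ i j, i ≠ j → IndepFun (X i) (X j) P)
    -- Cesàro uniform integrability of {‖X_n‖}
    (hUI : ∀ ε > (0 : ℝ), ∃ a : ℝ, 0 < a ∧ ∀ b ≥ a, ∀ n : Fin d → ℕ, (∀ j, 1 ≤ n j) →
      (1 / ∏ j, (n j : ℝ)) * ∑ i ∈ Finset.Icc 1 n,
        ∫ ω, Set.indicator {ω | b < ‖X i ω‖} (fun ω => ‖X i ω‖) ω ∂P ≤ ε) :
    ∀ ε > (0 : ℝ), ∃ N : ℕ, ∀ n : Fin d → ℕ, (∀ j, 1 ≤ n j) → N ≤ ∏ j, n j →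
      ∫ ω, ((((Finset.Icc 1 n).sup fun k =>
          ‖∑ i ∈ Finset.Icc 1 k, (X i ω - ∫ ω', X i ω' ∂P)‖₊ : NNReal) : ℝ) /
        ∏ j, (n j : ℝ)) ∂P < ε := by
  intro ε hε
  obtain ⟨a, ha, hUIa⟩ := hUI (ε / 8) (by positivity)
  obtain ⟨m, hm⟩ := exists_nat_gt (8 * a * d / ε)
  have hm0 : (0 : ℝ) < m := lt_of_le_of_lt (by positivity) hm
  obtain ⟨N, hN⟩ := exists_nat_gt ((8 * a * (m + 1) ^ d / ε) ^ 2)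
  refine ⟨N, fun n hn hNn => ?_⟩
  have hV : (0 : ℝ) < ∏ j, (n j : ℝ) := prod_pos fun j _ => by exact_mod_cast hn j
  have hNV : (N : ℝ) ≤ ∏ j, (n j : ℝ) := by exact_mod_cast hNn
  have htail := hUIa a le_rfl n hn
  have hbound := integral_sup_norm_sum_le hmeas hint hindep ha.le (Nat.cast_pos.1 hm0) n
  rw [integral_div, div_lt_iff₀ hV]
  refine hbound.trans_lt ?_
  set V := ∏ j, (n j : ℝ)
  rw [one_div, inv_mul_le_iff₀ hV] at htail
  have hsqrt : 8 * a * (m + 1) ^ d / ε < √V := Real.lt_sqrt_of_sq_lt (hN.trans_le hNV)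
  have h1 : (m + 1) ^ d * (2 * a * √V) ≤ ε / 4 * V := by
    rw [div_lt_iff₀ hε] at hsqrt
    nlinarith [Real.mul_self_sqrt hV.le, mul_le_mul_of_nonneg_right hsqrt.le (Real.sqrt_nonneg V)]
  have h2 : 2 * a * (d * V) / m ≤ ε / 4 * V := by
    rw [div_lt_iff₀ hε] at hm
    rw [div_le_iff₀ hm0]
    nlinarith [mul_le_mul_of_nonneg_right hm.le hV.le]
  nlinarith [mul_pos hε hV]
end

section
/- (Rademacher–Menshov-type maximal inequality in one dimension.) Let $X_1,\dots,X_n$ be pairwise independent mean-zero random vectors in a real separable Hilbert space with finite second moments. Then there is an absolute constant $C>0$ such that $\mathbb{E}\big(\max_{1\le k\le n}\|\sum_{i=1}^k X_i\|^2\big) \le C\,\log^2(2n)\,\sum_{i=1}^n\mathbb{E}\|X_i\|^2$. -/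
open MeasureTheory Finset ProbabilityTheory

section RademacherMenshov

lemma sum_Icc_one_eq_sum_range {M : Type*} [AddCommMonoid M] (f : ℕ → M) (k : ℕ) :
    ∑ i ∈ Finset.Icc 1 k, f i = ∑ i ∈ Finset.range k, f (1 + i) := by
  rw [← Finset.Ico_add_one_right_eq_Icc, Finset.sum_Ico_eq_sum_range, Nat.add_sub_cancel]

variable {E : Type*} [NormedAddCommGroup E]

/-- The sum of the squared norms of the left halves occurring in the dyadic subdivision of the
`2 ^ m` terms of `x` that start at index `a`, together with those of the single terms. -/
def dyadicEnergy (x : ℕ → E) : ℕ → ℕ → ℝ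
  | 0, a => ‖x a‖ ^ 2
  | m + 1, a => ‖∑ i ∈ Finset.range (2 ^ m), x (a + i)‖ ^ 2 +
      (dyadicEnergy x m a + dyadicEnergy x m (a + 2 ^ m))

lemma dyadicEnergy_nonneg (x : ℕ → E) (m a : ℕ) : 0 ≤ dyadicEnergy x m a := by
  induction m generalizing a with
  | zero => simp only [dyadicEnergy]; positivity
  | succ m ih =>
    have h₁ := ih a
    have h₂ := ih (a + 2 ^ m)
    simp only [dyadicEnergy]
    positivity

/-- Pathwise dyadic chaining bound for partial sums. -/
lemma norm_sum_range_sq_le_dyadicEnergy (x : ℕ → E) (m a k : ℕ) (hk : k ≤ 2 ^ m) :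
    ‖∑ i ∈ Finset.range k, x (a + i)‖ ^ 2 ≤ (m + 1) * dyadicEnergy x m a := by
  induction m generalizing a k with
  | zero =>
    obtain rfl | rfl : k = 0 ∨ k = 1 := by simp at hk; omega
    · simp [dyadicEnergy]
    · simp [dyadicEnergy]
  | succ m ih =>
    have h_left := dyadicEnergy_nonneg x m a
    have h_right := dyadicEnergy_nonneg x m (a + 2 ^ m)
    rcases le_total k (2 ^ m) with h | h
    · refine (ih a k h).trans ?_
      simp only [dyadicEnergy]
      push_cast
      gcongr
      · linarith
      · nlinarith [sq_nonneg ‖∑ i ∈ Finset.range (2 ^ m), x (a + i)‖]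
    · obtain ⟨l, rfl⟩ := Nat.exists_eq_add_of_le h
      have hl : l ≤ 2 ^ m := by rw [pow_succ] at hk; omega
      have ihr := ih (a + 2 ^ m) l hl
      rw [Finset.sum_range_add]
      simp only [dyadicEnergy, ← add_assoc]
      set s := ∑ i ∈ Finset.range (2 ^ m), x (a + i)
      set r := ∑ i ∈ Finset.range l, x (a + 2 ^ m + i)
      have h_tri : ‖s + r‖ ^ 2 ≤ (‖s‖ + ‖r‖) ^ 2 := by gcongr; exact norm_add_le s r
      have hm : (0 : ℝ) < m + 1 := by positivity
      have h_titu : (‖s‖ + ‖r‖) ^ 2 ≤ (m + 2) * (‖s‖ ^ 2 + ‖r‖ ^ 2 / (m + 1)) := by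
        have : (m + 2) * (‖s‖ ^ 2 + ‖r‖ ^ 2 / (m + 1)) - (‖s‖ + ‖r‖) ^ 2
            = ((m + 1) * ‖s‖ - ‖r‖) ^ 2 / (m + 1) := by field_simp; ring
        have : 0 ≤ ((m + 1) * ‖s‖ - ‖r‖) ^ 2 / (m + 1) := by positivity
        linarith
      have h_div : ‖r‖ ^ 2 / (m + 1) ≤ dyadicEnergy x m (a + 2 ^ m) := by
        rw [div_le_iff₀ hm]; linarith
      calc ‖s + r‖ ^ 2 ≤ (m + 2) * (‖s‖ ^ 2 + ‖r‖ ^ 2 / (m + 1)) := h_tri.trans h_titu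
        _ ≤ (m + 2) * (‖s‖ ^ 2 + dyadicEnergy x m a + dyadicEnergy x m (a + 2 ^ m)) := by
            gcongr; linarith
        _ = _ := by push_cast; ring

variable {Ω : Type*} [MeasurableSpace Ω] {μ : Measure Ω}

lemma integrable_dyadicEnergy {X : ℕ → Ω → E} (hX : ∀ i, MemLp (X i) 2 μ) (m a : ℕ) :
    Integrable (fun ω => dyadicEnergy (fun i => X i ω) m a) μ := by
  induction m generalizing a with
  | zero => exact (hX a).integrable_norm_pow (by simp)
  | succ m ih =>
    exact ((memLp_finsetSum _ fun i _ => hX (a + i)).integrable_norm_pow (by simp)).add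
      ((ih a).add (ih (a + 2 ^ m)))

variable [InnerProductSpace ℝ E]

lemma integral_norm_sum_sq_of_orthogonal {ι : Type*} {X : ι → Ω → E} (hX : ∀ i, MemLp (X i) 2 μ)
    (horth : ∀ i j, i ≠ j → ∫ ω, inner ℝ (X i ω) (X j ω) ∂μ = 0) (s : Finset ι) :
    ∫ ω, ‖∑ i ∈ s, X i ω‖ ^ 2 ∂μ = ∑ i ∈ s, ∫ ω, ‖X i ω‖ ^ 2 ∂μ := by
  have h_int i j : Integrable (fun ω => inner ℝ (X i ω) (X j ω)) μ :=
    ((hX i).norm.integrable_mul (hX j).norm).mono' ((hX i).1.inner (hX j).1)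
      (.of_forall fun ω => norm_inner_le_norm (X i ω) (X j ω))
  simp_rw [← real_inner_self_eq_norm_sq, sum_inner, inner_sum]
  rw [integral_finsetSum _ fun i _ => integrable_finsetSum _ fun j _ => h_int i j]
  refine Finset.sum_congr rfl fun i hi => ?_
  rw [integral_finsetSum _ fun j _ => h_int i j]
  exact Finset.sum_eq_single_of_mem i hi fun j _ hj => horth i j hj.symm

lemma integral_dyadicEnergy_le {X : ℕ → Ω → E} (hX : ∀ i, MemLp (X i) 2 μ)
    (horth : ∀ i j, i ≠ j → ∫ ω, inner ℝ (X i ω) (X j ω) ∂μ = 0) (m a : ℕ) :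
    ∫ ω, dyadicEnergy (fun i => X i ω) m a ∂μ ≤
      (m + 1) * ∑ i ∈ Finset.range (2 ^ m), ∫ ω, ‖X (a + i) ω‖ ^ 2 ∂μ := by
  induction m generalizing a with
  | zero => simp [dyadicEnergy]
  | succ m ih =>
    have h_left := ih a
    have h_right := ih (a + 2 ^ m)
    have h_sum := integral_norm_sum_sq_of_orthogonal (fun i => hX (a + i))
      (fun i j hij => horth _ _ fun h => hij (Nat.add_left_cancel h)) (Finset.range (2 ^ m))
    simp only [dyadicEnergy]
    have h_int := (integrable_dyadicEnergy hX m a).add (integrable_dyadicEnergy hX m (a + 2 ^ m))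
    simp only [Pi.add_def] at h_int
    rw [integral_add
        ((memLp_finsetSum _ fun i _ => hX (a + i)).integrable_norm_pow (by simp)) h_int,
      integral_add (integrable_dyadicEnergy hX m a) (integrable_dyadicEnergy hX m (a + 2 ^ m)),
      h_sum, pow_succ, mul_two, Finset.sum_range_add]
    simp only [← add_assoc]
    have h_nonneg : 0 ≤ ∑ i ∈ Finset.range (2 ^ m), ∫ ω, ‖X (a + 2 ^ m + i) ω‖ ^ 2 ∂μ :=
      Finset.sum_nonneg fun i _ => integral_nonneg fun ω => by positivity
    push_cast
    linarith

/-- The Rademacher–Menshov inequality for the first `n ≤ 2 ^ m` partial sums of orthogonal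
square-integrable random vectors. -/
lemma integral_sup_norm_sum_sq_le {X : ℕ → Ω → E} (hX : ∀ i, MemLp (X i) 2 μ)
    (horth : ∀ i j, i ≠ j → ∫ ω, inner ℝ (X i ω) (X j ω) ∂μ = 0) {n m : ℕ} (hn : n ≤ 2 ^ m) :
    ∫ ω, (((Finset.Icc 1 n).sup fun k => ‖∑ i ∈ Finset.Icc 1 k, X i ω‖₊ : NNReal) : ℝ) ^ 2 ∂μ ≤
      (m + 1) ^ 2 * ∑ i ∈ Finset.Icc 1 n, ∫ ω, ‖X i ω‖ ^ 2 ∂μ := by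
  let Y : ℕ → Ω → E := fun i => if i ∈ Finset.Icc 1 n then X i else 0
  have hY i : MemLp (Y i) 2 μ := by
    by_cases hi : i ∈ Finset.Icc 1 n
    · simpa only [Y, if_pos hi] using hX i
    · simp only [Y, if_neg hi, MemLp.zero]
  have hY_orth i j (hij : i ≠ j) : ∫ ω, inner ℝ (Y i ω) (Y j ω) ∂μ = 0 := by
    by_cases hi : i ∈ Finset.Icc 1 n
    · by_cases hj : j ∈ Finset.Icc 1 n
      · simpa only [Y, if_pos hi, if_pos hj] using horth i j hij
      · simp only [Y, if_neg hj, Pi.zero_apply, inner_zero_right, integral_zero]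
    · simp only [Y, if_neg hi, Pi.zero_apply, inner_zero_left, integral_zero]
  have h_path ω : (((Finset.Icc 1 n).sup fun k =>
      ‖∑ i ∈ Finset.Icc 1 k, X i ω‖₊ : NNReal) : ℝ) ^ 2 ≤
        (m + 1) * dyadicEnergy (fun i => Y i ω) m 1 := by
    rcases (Finset.Icc 1 n).eq_empty_or_nonempty with h | h
    · have := dyadicEnergy_nonneg (fun i => Y i ω) m 1
      simp only [h, Finset.sup_empty, bot_eq_zero', NNReal.coe_zero, zero_pow two_ne_zero]
      positivity
    · obtain ⟨k, hk, h_sup⟩ := Finset.exists_mem_eq_sup _ h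
        fun k => ‖∑ i ∈ Finset.Icc 1 k, X i ω‖₊
      have hkn := (Finset.mem_Icc.1 hk).2
      have h_eq : ∑ i ∈ Finset.Icc 1 k, X i ω = ∑ i ∈ Finset.range k, Y (1 + i) ω := by
        rw [← sum_Icc_one_eq_sum_range fun i => Y i ω]
        refine Finset.sum_congr rfl fun i hi => ?_
        simp only [Y, if_pos (Finset.Icc_subset_Icc_right hkn hi)]
      rw [h_sup, coe_nnnorm, h_eq]
      exact norm_sum_range_sq_le_dyadicEnergy (fun i => Y i ω) m 1 k (hkn.trans hn)
  have h_energy : ∑ i ∈ Finset.range (2 ^ m), ∫ ω, ‖Y (1 + i) ω‖ ^ 2 ∂μ =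
      ∑ i ∈ Finset.Icc 1 n, ∫ ω, ‖X i ω‖ ^ 2 ∂μ := by
    rw [← sum_Icc_one_eq_sum_range fun i => ∫ ω, ‖Y i ω‖ ^ 2 ∂μ]
    refine (Finset.sum_subset_zero_on_sdiff (Finset.Icc_subset_Icc_right hn)
      (fun i hi => ?_) fun i hi => ?_).symm
    · simp only [Y, if_neg (Finset.mem_sdiff.1 hi).2, Pi.zero_apply, norm_zero,
        zero_pow two_ne_zero, integral_zero]
    · simp only [Y, if_pos hi]
  calc _ ≤ ∫ ω, (m + 1) * dyadicEnergy (fun i => Y i ω) m 1 ∂μ :=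
        integral_mono_of_nonneg (.of_forall fun ω => by positivity)
          ((integrable_dyadicEnergy hY m 1).const_mul _) (.of_forall h_path)
    _ ≤ (m + 1) * ((m + 1) * ∑ i ∈ Finset.range (2 ^ m), ∫ ω, ‖Y (1 + i) ω‖ ^ 2 ∂μ) := by
        rw [integral_const_mul]
        gcongr
        exact integral_dyadicEnergy_le hY hY_orth m 1
    _ = _ := by rw [h_energy]; ring

end RademacherMenshov

/-- One-dimensional Rademacher–Menshov-type maximal inequality for pairwise independent
mean-zero Hilbert-space random vectors. -/
theorem maximal_inequality_one_dim
    {Ω H : Type*} [MeasurableSpace Ω]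
    [NormedAddCommGroup H] [InnerProductSpace ℝ H] [CompleteSpace H]
    [SecondCountableTopology H] [MeasurableSpace H] [BorelSpace H]
    (P : Measure Ω) [IsProbabilityMeasure P] :
    ∃ C > (0 : ℝ), ∀ (n : ℕ) (X : ℕ → Ω → H),
      (∀ i, Measurable (X i)) →
      (∀ i, Integrable (fun ω => ‖X i ω‖ ^ 2) P) →
      (∀ i, ∫ ω, X i ω ∂P = 0) →
      (∀ i j, i ≠ j → IndepFun (X i) (X j) P) →
      ∫ ω, ((((Finset.Icc 1 n).sup fun k =>
          ‖∑ i ∈ Finset.Icc 1 k, X i ω‖₊ : NNReal) : ℝ)) ^ 2 ∂P ≤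
        C * Real.log (2 * n) ^ 2 * ∑ i ∈ Finset.Icc 1 n, ∫ ω, ‖X i ω‖ ^ 2 ∂P := by
  refine ⟨4 / Real.log 2 ^ 2, by positivity, fun n X h_meas h_sq h_mean h_indep => ?_⟩
  have hX i : MemLp (X i) 2 P :=
    (memLp_two_iff_integrable_sq_norm (h_meas i).aestronglyMeasurable).2 (h_sq i)
  have horth i j (hij : i ≠ j) : ∫ ω, inner ℝ (X i ω) (X j ω) ∂P = 0 := by
    have h := (h_indep i j hij).integral_bilin ((hX i).integrable (by norm_num))
      ((hX j).integrable (by norm_num)) (innerSL ℝ)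
    exact h.trans (by rw [h_mean i, map_zero, _root_.zero_apply])
  rcases Nat.eq_zero_or_pos n with rfl | hn
  · simp
  set m := Nat.log 2 n + 1
  have h_lt : n < 2 ^ m := Nat.lt_pow_succ_log_self one_lt_two n
  have h_pow : 2 ^ m ≤ 2 * n := by
    have := Nat.pow_log_le_self 2 hn.ne'
    rw [pow_succ]; omega
  have h_log : m * Real.log 2 ≤ Real.log (2 * n) := by
    rw [← Real.log_pow]
    exact Real.log_le_log (by positivity) (mod_cast h_pow)
  refine (integral_sup_norm_sum_sq_le hX horth h_lt.le).trans ?_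
  gcongr
  have hm : (1 : ℝ) ≤ m := by simp [m]
  have h_log_two : 0 < Real.log 2 := Real.log_pos one_lt_two
  rw [div_mul_eq_mul_div, le_div_iff₀ (by positivity), ← mul_pow]
  calc ((m + 1) * Real.log 2) ^ 2 ≤ (2 * Real.log (2 * n)) ^ 2 := by
        refine pow_le_pow_left₀ (by positivity) ?_ 2
        nlinarith
    _ = 4 * Real.log (2 * n) ^ 2 := by ring
end
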